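/- Let L be a Lagrangian subspace of V = ℝ^{2n_A} × ℝ^{2n_B} with the product symplectic form. Then the radical of σ_A restricted to π_A(L) equals L_A, i.e., {u ∈ π_A(L) : σ_A(u, w) = 0 for all w ∈ π_A(L)} = L_A. Equivalently, for every subspace W of L with L = (L_A × {0}) ⊕ ({0} × L_B) ⊕ W, the form σ_A restricted to π_A(W) is nondegenerate. -/

import Mathlib

open scoped BigOperators

namespace EntTrim

/-- The standard symplectic form on `ℝ^(2m)`:
`σ(v, w) = Σ_{i=1}^m (v_{2i-1} * w_{2i} - v_{2i} * w_{2i-1})` (zero-based indexing). -/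
def stdSymp (m : ℕ) (v w : Fin (2 * m) → ℝ) : ℝ :=
  ∑ i : Fin m,
    (v ⟨2 * (i : ℕ), by have := i.isLt; omega⟩ *
        w ⟨2 * (i : ℕ) + 1, by have := i.isLt; omega⟩ -
      v ⟨2 * (i : ℕ) + 1, by have := i.isLt; omega⟩ *
        w ⟨2 * (i : ℕ), by have := i.isLt; omega⟩)

/-- The product symplectic form on `ℝ^(2nA) × ℝ^(2nB)`:
`σ((u_A,u_B),(w_A,w_B)) = σ_A(u_A,w_A) + σ_B(u_B,w_B)`. -/
def prodSymp (nA nB : ℕ) (u w : (Fin (2 * nA) → ℝ) × (Fin (2 * nB) → ℝ)) : ℝ :=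
  stdSymp nA u.1 w.1 + stdSymp nB u.2 w.2

/-- The standard symplectic form as a bilinear form. -/
noncomputable def stdSympForm (m : ℕ) : LinearMap.BilinForm ℝ (Fin (2 * m) → ℝ) :=
  LinearMap.mk₂ ℝ (stdSymp m)
    (fun u v w => by
      simp only [stdSymp, Pi.add_apply, ← Finset.sum_add_distrib]
      exact Finset.sum_congr rfl fun i _ => by ring)
    (fun c u v => by
      simp only [stdSymp, Pi.smul_apply, smul_eq_mul, Finset.mul_sum]
      exact Finset.sum_congr rfl fun i _ => by ring)
    (fun u v w => by
      simp only [stdSymp, Pi.add_apply, ← Finset.sum_add_distrib]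
      exact Finset.sum_congr rfl fun i _ => by ring)
    (fun c u v => by
      simp only [stdSymp, Pi.smul_apply, smul_eq_mul, Finset.mul_sum]
      exact Finset.sum_congr rfl fun i _ => by ring)

@[simp]
theorem stdSympForm_apply (m : ℕ) (u v : Fin (2 * m) → ℝ) :
    stdSympForm m u v = stdSymp m u v := rfl

theorem stdSymp_self (m : ℕ) (v : Fin (2 * m) → ℝ) : stdSymp m v v = 0 :=
  Finset.sum_eq_zero fun i _ => by ring

@[simp]
theorem stdSymp_zero_left (m : ℕ) (v : Fin (2 * m) → ℝ) : stdSymp m 0 v = 0 :=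
  LinearMap.map_zero₂ (stdSympForm m) v

@[simp]
theorem stdSymp_zero_right (m : ℕ) (v : Fin (2 * m) → ℝ) : stdSymp m v 0 = 0 :=
  map_zero (stdSympForm m v)

/-- The standard complex structure on `ℝ^(2m)`, which pairs with `stdSymp` to give the
Euclidean inner product. -/
def stdComplexStructure (m : ℕ) (v : Fin (2 * m) → ℝ) (j : Fin (2 * m)) : ℝ :=
  if h : (j : ℕ) % 2 = 0 then -v ⟨j + 1, by have := j.isLt; omega⟩
  else v ⟨j - 1, by have := j.isLt; omega⟩

theorem stdSymp_stdComplexStructure (m : ℕ) (v : Fin (2 * m) → ℝ) :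
    stdSymp m v (stdComplexStructure m v) =
      ∑ i : Fin m, (v ⟨2 * (i : ℕ), by have := i.isLt; omega⟩ ^ 2 +
        v ⟨2 * (i : ℕ) + 1, by have := i.isLt; omega⟩ ^ 2) := by
  refine Finset.sum_congr rfl fun i _ => ?_
  have h : (2 * (i : ℕ) + 1) % 2 ≠ 0 := by omega
  simp only [stdComplexStructure, Nat.mul_mod_right, h, dite_true, dite_false,
    Nat.add_sub_cancel]
  ring

theorem separatingLeft_stdSympForm (m : ℕ) : (stdSympForm m).SeparatingLeft := by
  intro v hv
  have hsum := hv (stdComplexStructure m v)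
  rw [stdSympForm_apply, stdSymp_stdComplexStructure,
    Finset.sum_eq_zero_iff_of_nonneg fun i _ => by positivity] at hsum
  ext ⟨j, hj⟩
  have hsq := hsum ⟨j / 2, by omega⟩ (Finset.mem_univ _)
  obtain ⟨h0, h1⟩ := (add_eq_zero_iff_of_nonneg (sq_nonneg _) (sq_nonneg _)).1 hsq
  rcases Nat.mod_two_eq_zero_or_one j with hpar | hpar
  · have hj' : 2 * (j / 2) = j := by omega
    simpa [hj'] using h0
  · have hj' : 2 * (j / 2) + 1 = j := by omega
    simpa [hj'] using h1

/-- The product symplectic form as a bilinear form. -/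
noncomputable def prodSympForm (nA nB : ℕ) :
    LinearMap.BilinForm ℝ ((Fin (2 * nA) → ℝ) × (Fin (2 * nB) → ℝ)) :=
  (stdSympForm nA).compl₁₂ (LinearMap.fst ℝ _ _) (LinearMap.fst ℝ _ _) +
    (stdSympForm nB).compl₁₂ (LinearMap.snd ℝ _ _) (LinearMap.snd ℝ _ _)

@[simp]
theorem prodSympForm_apply (nA nB : ℕ) (u v : (Fin (2 * nA) → ℝ) × (Fin (2 * nB) → ℝ)) :
    prodSympForm nA nB u v = prodSymp nA nB u v := rfl

theorem isAlt_prodSympForm (nA nB : ℕ) : (prodSympForm nA nB).IsAlt := fun u => by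
  simp [prodSymp, stdSymp_self]

theorem nondegenerate_prodSympForm (nA nB : ℕ) : (prodSympForm nA nB).Nondegenerate := by
  refine (isAlt_prodSympForm nA nB).isRefl.nondegenerate_iff_separatingLeft.2 fun u hu => ?_
  refine Prod.ext (separatingLeft_stdSympForm nA _ fun v => ?_)
    (separatingLeft_stdSympForm nB _ fun v => ?_)
  · simpa [prodSymp] using hu (v, 0)
  · simpa [prodSymp] using hu (0, v)

/-- A Lagrangian subspace equals its symplectic complement. -/
theorem orthogonal_prodSympForm_eq_self {nA nB : ℕ}
    {L : Submodule ℝ ((Fin (2 * nA) → ℝ) × (Fin (2 * nB) → ℝ))}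
    (hiso : ∀ u ∈ L, ∀ w ∈ L, prodSymp nA nB u w = 0)
    (hdim : Module.finrank ℝ L = nA + nB) :
    (prodSympForm nA nB).orthogonal L = L := by
  have hle : L ≤ (prodSympForm nA nB).orthogonal L := fun w hw u hu => hiso u hu w hw
  refine (Submodule.eq_of_le_of_finrank_eq hle ?_).symm
  rw [LinearMap.BilinForm.finrank_orthogonal (nondegenerate_prodSympForm nA nB), hdim]
  simp only [Module.finrank_prod, Module.finrank_fin_fun]
  omega

/-- For a Lagrangian subspace `L` of `ℝ^(2nA) × ℝ^(2nB)`, the radical of `σ_A` restricted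
to the projection `π_A(L)` equals `L_A = {u : (u,0) ∈ L}`. -/
theorem radical_of_projected_lagrangian (nA nB : ℕ)
    (L : Submodule ℝ ((Fin (2 * nA) → ℝ) × (Fin (2 * nB) → ℝ)))
    (hiso : ∀ u ∈ L, ∀ w ∈ L, prodSymp nA nB u w = 0)
    (hdim : Module.finrank ℝ L = nA + nB) :
    {u : Fin (2 * nA) → ℝ |
        u ∈ Submodule.map (LinearMap.fst ℝ (Fin (2 * nA) → ℝ) (Fin (2 * nB) → ℝ)) L ∧
        ∀ w ∈ Submodule.map (LinearMap.fst ℝ (Fin (2 * nA) → ℝ) (Fin (2 * nB) → ℝ)) L,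
          stdSymp nA u w = 0} =
      {u : Fin (2 * nA) → ℝ | (u, (0 : Fin (2 * nB) → ℝ)) ∈ L} := by
  ext u
  simp only [Set.mem_ofPred_eq, Submodule.mem_map, LinearMap.fst_apply]
  constructor
  · rintro ⟨-, hu⟩
    rw [← orthogonal_prodSympForm_eq_self hiso hdim]
    refine fun w hw => (isAlt_prodSympForm nA nB).isRefl _ _ ?_
    simpa [prodSymp] using hu w.1 ⟨w, hw, rfl⟩
  · refine fun hu => ⟨⟨_, hu, rfl⟩, ?_⟩
    rintro _ ⟨w, hw, rfl⟩
    simpa [prodSymp] using hiso _ hu w hw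

end EntTrim
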